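/- (Horowitz, ℚ-version) Let G be a group generated by elements g_1, …, g_n. Then every Fricke character tr x, for x ∈ G, lies in the ℚ-subalgebra of F(R(G),ℂ) generated by the finitely many elements tr(g_{i_1}g_{i_2}⋯g_{i_l}) with 1 ≤ l ≤ 3 and 1 ≤ i_1 < i_2 < ⋯ < i_l ≤ n. Equivalently, the ℚ-algebra homomorphism π from the polynomial ring ℚ[t_{i_1⋯i_l} : 1 ≤ l ≤ 3, 1 ≤ i_1 < ⋯ < i_l ≤ n] to F(R(G),ℂ) defined by π(t_{i_1⋯i_l}) = tr(g_{i_1}⋯g_{i_l}) has image containing 𝔛_ℚ(G), i.e. π : 𝔓 → 𝔛_ℚ(G) is surjective. -/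

import Mathlib

set_option synthInstance.maxHeartbeats 1000000
set_option maxHeartbeats 1000000

noncomputable section

abbrev SL2 : Type := Matrix.SpecialLinearGroup (Fin 2) ℂ

/-- The Fricke character `tr x ∈ F(R(G),ℂ)` of an element `x` of a group `G`. -/
def trG {G : Type*} [Group G] (x : G) : (G →* SL2) → ℂ :=
  fun ρ => Matrix.trace ((ρ x : Matrix (Fin 2) (Fin 2) ℂ))

section TraceIdentities

variable {R : Type*} [CommRing R]

/-- The fundamental trace identity for four `2 × 2` matrices. -/
lemma Matrix.two_mul_trace_mul_mul_mul_fin_two (x a b c : Matrix (Fin 2) (Fin 2) R) :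
    2 * (x * a * b * c).trace =
      x.trace * (a * b * c).trace + a.trace * (x * b * c).trace
        + b.trace * (x * a * c).trace + c.trace * (x * a * b).trace
        + (x * a).trace * (b * c).trace - (x * b).trace * (a * c).trace
        + (x * c).trace * (a * b).trace
        - x.trace * a.trace * (b * c).trace - x.trace * c.trace * (a * b).trace
        - a.trace * b.trace * (x * c).trace - b.trace * c.trace * (x * a).trace
        + x.trace * a.trace * b.trace * c.trace := by
  simp only [Matrix.trace_fin_two, Matrix.mul_apply, Fin.sum_univ_two]
  ring

/-- The trace identity relating the two cyclic orders of three `2 × 2` matrices. -/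
lemma Matrix.trace_mul_mul_add_trace_mul_mul_fin_two (a b c : Matrix (Fin 2) (Fin 2) R) :
    (a * b * c).trace + (a * c * b).trace =
      a.trace * (b * c).trace + b.trace * (a * c).trace + c.trace * (a * b).trace
        - a.trace * b.trace * c.trace := by
  simp only [Matrix.trace_fin_two, Matrix.mul_apply, Fin.sum_univ_two]
  ring

/-- The Cayley–Hamilton relation in `SL₂`, in trace form. -/
lemma Matrix.SpecialLinearGroup.trace_mul_inv_mul_fin_two
    (x a y : Matrix.SpecialLinearGroup (Fin 2) R) :
    (x * a⁻¹ * y).1.trace = a.1.trace * (x * y).1.trace - (x * a * y).1.trace := by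
  simp only [Matrix.SpecialLinearGroup.coe_mul, Matrix.SpecialLinearGroup.coe_inv,
    Matrix.adjugate_fin_two, Matrix.trace_fin_two, Matrix.mul_apply, Fin.sum_univ_two,
    Matrix.of_apply, Matrix.cons_val', Matrix.cons_val_zero, Matrix.cons_val_one,
    Matrix.cons_val_fin_one]
  ring

end TraceIdentities

section FrickeCharacters

variable {G : Type*} [Group G]

lemma trG_one : trG (1 : G) = 2 := by
  funext ρ
  simp [trG]

lemma trG_mul_comm (x y : G) : trG (x * y) = trG (y * x) := by
  funext ρ
  simp [trG, Matrix.trace_mul_comm (ρ x).1]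

lemma trG_mul_inv_mul (x a y : G) :
    trG (x * a⁻¹ * y) = trG a * trG (x * y) - trG (x * a * y) := by
  funext ρ
  simpa [trG] using
    Matrix.SpecialLinearGroup.trace_mul_inv_mul_fin_two (ρ x) (ρ a) (ρ y)

lemma trG_mul_self_mul (a y : G) : trG (a * a * y) = trG a * trG (a * y) - trG y := by
  have h := trG_mul_inv_mul a a y
  rw [mul_inv_cancel, one_mul] at h
  rw [h, sub_sub_cancel]

lemma trG_mul_mul_swap (a b c : G) :
    trG (a * c * b) =
      trG a * trG (b * c) + trG b * trG (a * c) + trG c * trG (a * b)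
        - trG a * trG b * trG c - trG (a * b * c) := by
  rw [eq_sub_iff_add_eq']
  funext ρ
  simpa [trG] using
    Matrix.trace_mul_mul_add_trace_mul_mul_fin_two (ρ a).1 (ρ b).1 (ρ c).1

lemma trG_mul_mul_mul (x a b c : G) :
    trG (x * a * b * c) = (2⁻¹ : ℚ) •
      (trG x * trG (a * b * c) + trG a * trG (x * b * c)
        + trG b * trG (x * a * c) + trG c * trG (x * a * b)
        + trG (x * a) * trG (b * c) - trG (x * b) * trG (a * c)
        + trG (x * c) * trG (a * b)
        - trG x * trG a * trG (b * c) - trG x * trG c * trG (a * b)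
        - trG a * trG b * trG (x * c) - trG b * trG c * trG (x * a)
        + trG x * trG a * trG b * trG c) := by
  rw [eq_inv_smul_iff₀ two_ne_zero]
  funext ρ
  have h := Matrix.two_mul_trace_mul_mul_mul_fin_two (ρ x).1 (ρ a).1 (ρ b).1 (ρ c).1
  simpa [trG, Rat.smul_def] using h

/-- A `ℚ`-subalgebra containing the characters of all products of at most three generators
contains every Fricke character. -/
lemma trG_mem_of_generates {ι : Type*} {g : ι → G} (hg : Subgroup.closure (Set.range g) = ⊤)
    {B : Subalgebra ℚ ((G →* SL2) → ℂ)} (h₁ : ∀ i, trG (g i) ∈ B)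
    (h₂ : ∀ i j, trG (g i * g j) ∈ B) (h₃ : ∀ i j k, trG (g i * g j * g k) ∈ B) (x : G) :
    trG x ∈ B := by
  suffices h : trG x ∈ B ∧ (∀ i, trG (x * g i) ∈ B) ∧ ∀ i j, trG (x * g i * g j) ∈ B from h.1
  have hx : x ∈ Subgroup.closure (Set.range g) := hg ▸ Subgroup.mem_top x
  have step : ∀ y : G, (trG y ∈ B ∧ (∀ i, trG (y * g i) ∈ B) ∧
      ∀ i j, trG (y * g i * g j) ∈ B) → ∀ k i j, trG (y * g k * g i * g j) ∈ B := by
    rintro y ⟨hy, hy₁, hy₂⟩ k i j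
    rw [trG_mul_mul_mul]
    refine B.smul_mem ?_ _
    refine B.add_mem ?_ (B.mul_mem (B.mul_mem (B.mul_mem hy (h₁ k)) (h₁ i)) (h₁ j))
    refine B.sub_mem ?_ (B.mul_mem (B.mul_mem (h₁ i) (h₁ j)) (hy₁ k))
    refine B.sub_mem ?_ (B.mul_mem (B.mul_mem (h₁ k) (h₁ i)) (hy₁ j))
    refine B.sub_mem ?_ (B.mul_mem (B.mul_mem hy (h₁ j)) (h₂ k i))
    refine B.sub_mem ?_ (B.mul_mem (B.mul_mem hy (h₁ k)) (h₂ i j))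
    refine B.add_mem ?_ (B.mul_mem (hy₁ j) (h₂ k i))
    refine B.sub_mem ?_ (B.mul_mem (hy₁ i) (h₂ k j))
    refine B.add_mem ?_ (B.mul_mem (hy₁ k) (h₂ i j))
    refine B.add_mem ?_ (B.mul_mem (h₁ j) (hy₂ k i))
    refine B.add_mem ?_ (B.mul_mem (h₁ i) (hy₂ k j))
    refine B.add_mem ?_ (B.mul_mem (h₁ k) (hy₂ i j))
    exact B.mul_mem hy (h₃ k i j)
  induction hx using Subgroup.closure_induction_right with
  | one =>
    simp only [one_mul]
    exact ⟨trG_one (G := G) ▸ ofNat_mem B 2, h₁, h₂⟩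
  | mul_right y hy z hz ih =>
    obtain ⟨k, rfl⟩ := hz
    exact ⟨ih.2.1 k, ih.2.2 k, step y ih k⟩
  | mul_inv_cancel y hy z hz ih =>
    obtain ⟨k, rfl⟩ := hz
    refine ⟨?_, fun i => ?_, fun i j => ?_⟩
    · have h := trG_mul_inv_mul y (g k) 1
      simp only [mul_one] at h
      rw [h]
      exact B.sub_mem (B.mul_mem (h₁ k) ih.1) (ih.2.1 k)
    · rw [trG_mul_inv_mul]
      exact B.sub_mem (B.mul_mem (h₁ k) (ih.2.1 i)) (ih.2.2 k i)
    · rw [mul_assoc, trG_mul_inv_mul, ← mul_assoc, ← mul_assoc]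
      exact B.sub_mem (B.mul_mem (h₁ k) (ih.2.2 i j)) (step y ih k i j)

end FrickeCharacters

/-- **Theorem 2.1 (Horowitz, ℚ-version)**: if `G` is generated by `g_1, …, g_n`, then every
Fricke character `tr x`, `x ∈ G`, lies in the ℚ-subalgebra of `F(R(G),ℂ)` generated by the
characters `tr(g_{i_1}⋯g_{i_l})` for `1 ≤ l ≤ 3` and `1 ≤ i_1 < ⋯ < i_l ≤ n`; equivalently,
`π : 𝔓 → 𝔛_ℚ(G)` is surjective. -/
theorem trG_mem_adjoin_of_generates {G : Type*} [Group G] (n : ℕ) (g : Fin n → G)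
    (hg : Subgroup.closure (Set.range g) = ⊤) (x : G) :
    trG x ∈ Algebra.adjoin ℚ {f : (G →* SL2) → ℂ |
      (∃ i : Fin n, f = trG (g i)) ∨
      (∃ i j : Fin n, i < j ∧ f = trG (g i * g j)) ∨
      (∃ i j k : Fin n, i < j ∧ j < k ∧ f = trG (g i * g j * g k))} := by
  set B := Algebra.adjoin ℚ {f : (G →* SL2) → ℂ |
      (∃ i : Fin n, f = trG (g i)) ∨
      (∃ i j : Fin n, i < j ∧ f = trG (g i * g j)) ∨
      (∃ i j k : Fin n, i < j ∧ j < k ∧ f = trG (g i * g j * g k))}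
  have h₁ : ∀ i, trG (g i) ∈ B := fun i => Algebra.subset_adjoin (Or.inl ⟨i, rfl⟩)
  have h₂ : ∀ i j, trG (g i * g j) ∈ B := by
    have hlt : ∀ i j, i < j → trG (g i * g j) ∈ B := fun i j hij =>
      Algebra.subset_adjoin (Or.inr (Or.inl ⟨i, j, hij, rfl⟩))
    intro i j
    rcases lt_trichotomy i j with hij | rfl | hij
    · exact hlt i j hij
    · have h := trG_mul_self_mul (g i) 1
      rw [mul_one, mul_one, trG_one] at h
      rw [h]
      exact B.sub_mem (B.mul_mem (h₁ i) (h₁ i)) (ofNat_mem B 2)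
    · rw [trG_mul_comm]
      exact hlt j i hij
  have hrot : ∀ i j k, trG (g i * g j * g k) ∈ B → trG (g j * g k * g i) ∈ B := by
    intro i j k h
    rwa [mul_assoc, trG_mul_comm] at h
  have hswap : ∀ i j k, trG (g i * g j * g k) ∈ B → trG (g i * g k * g j) ∈ B := by
    intro i j k h
    rw [trG_mul_mul_swap]
    refine B.sub_mem (B.sub_mem (B.add_mem (B.add_mem ?_ ?_) ?_) ?_) h
    · exact B.mul_mem (h₁ i) (h₂ j k)
    · exact B.mul_mem (h₁ j) (h₂ i k)
    · exact B.mul_mem (h₁ k) (h₂ i j)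
    · exact B.mul_mem (B.mul_mem (h₁ i) (h₁ j)) (h₁ k)
  have hself : ∀ i k, trG (g i * g i * g k) ∈ B := by
    intro i k
    rw [trG_mul_self_mul]
    exact B.sub_mem (B.mul_mem (h₁ i) (h₂ i k)) (h₁ k)
  have hlt : ∀ i j k, i < j → j < k → trG (g i * g j * g k) ∈ B := fun i j k hij hjk =>
    Algebra.subset_adjoin (Or.inr (Or.inr ⟨i, j, k, hij, hjk, rfl⟩))
  refine trG_mem_of_generates hg h₁ h₂ (fun i j k => ?_) x
  rcases lt_trichotomy i j with hij | rfl | hij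
  · rcases lt_trichotomy j k with hjk | rfl | hjk
    · exact hlt i j k hij hjk
    · exact hrot _ _ _ (hrot _ _ _ (hself j i))
    · rcases lt_trichotomy i k with hik | rfl | hik
      · exact hswap _ _ _ (hlt i k j hik hjk)
      · exact hswap _ _ _ (hself i j)
      · exact hrot _ _ _ (hlt k i j hik hij)
  · exact hself i k
  · rcases lt_trichotomy i k with hik | rfl | hik
    · exact hrot _ _ _ (hrot _ _ _ (hswap _ _ _ (hlt j i k hij hik)))
    · exact hswap _ _ _ (hself i j)
    · rcases lt_trichotomy j k with hjk | rfl | hjk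
      · exact hrot _ _ _ (hrot _ _ _ (hlt j k i hjk hik))
      · exact hrot _ _ _ (hrot _ _ _ (hself j i))
      · exact hswap _ _ _ (hrot _ _ _ (hrot _ _ _ (hlt k j i hjk hij)))
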